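/- arXiv:1106.1007 — 2 statements merged into one kernel-verified Lean document; each statement's English description precedes it below -/
import Mathlib

section
/- For n = 2m with m ≥ 4, let Φ be the set of equipartitions of [n]. Then there exists a 3-coloring c : Φ → {B, R, Y} such that the identity is the only permutation of [n] that preserves the color of every equipartition under the induced action of S_n on Φ (i.e., if a permutation σ of [n] satisfies c({σ(P), σ([n]∖P)}) = c({P, [n]∖P}) for every m-subset P of [n], then σ is the identity). -/
namespace EquipartitionColoring

open Finset

/-- The even elements of `Fin (2 * m)`, one half of a distinguished equipartition. -/
def evens (m : ℕ) : Finset (Fin (2 * m)) := univ.filter fun x => x.val % 2 = 0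

/-- The set obtained from `evens m` by exchanging `u` for `v`. -/
def exchange {m : ℕ} (u v : Fin (2 * m)) : Finset (Fin (2 * m)) := insert v ((evens m).erase u)

/-- The path `0, 1, …, 2 * m - 2` with an additional leaf `2 * m - 1` attached at `2`. -/
def SpiderAdj (m x y : ℕ) : Prop :=
  (x + 1 = y ∧ y ≠ 2 * m - 1) ∨ (y + 1 = x ∧ x ≠ 2 * m - 1) ∨
    (x = 2 ∧ y = 2 * m - 1) ∨ (y = 2 ∧ x = 2 * m - 1)

lemma SpiderAdj.symm {m x y : ℕ} (h : SpiderAdj m x y) : SpiderAdj m y x := by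
  unfold SpiderAdj at *; omega

lemma mem_evens {m : ℕ} {x : Fin (2 * m)} : x ∈ evens m ↔ x.val % 2 = 0 := by
  simp [evens]

lemma mem_exchange {m : ℕ} {u v x : Fin (2 * m)} :
    x ∈ exchange u v ↔ x = v ∨ (x ≠ u ∧ x.val % 2 = 0) := by
  simp [exchange, mem_evens]

lemma card_evens (m : ℕ) : (evens m).card = m := by
  have h : evens m = univ.image fun i : Fin m => (⟨2 * i.val, by omega⟩ : Fin (2 * m)) := by
    ext x
    simp only [mem_evens, mem_image, mem_univ, true_and]
    constructor
    · intro hx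
      exact ⟨⟨x.val / 2, by omega⟩, Fin.ext (by simp only; omega)⟩
    · rintro ⟨i, rfl⟩
      simp
  rw [h, card_image_of_injective, card_univ, Fintype.card_fin]
  intro i j hij
  simp only [Fin.mk.injEq] at hij
  omega

lemma card_exchange {m : ℕ} {u v : Fin (2 * m)} (hu : u.val % 2 = 0) (hv : v.val % 2 = 1) :
    (exchange u v).card = m := by
  have hv' : v ∉ (evens m).erase u := by
    simp [mem_evens, hv]
  have hu' : u ∈ evens m := mem_evens.2 hu
  rw [exchange, card_insert_of_notMem hv', card_erase_of_mem hu', card_evens]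
  omega

/-- A set encodes an edge of the spider if it, or its complement, is the exchange along an edge. -/
def IsEdgeSet (m : ℕ) (P : Finset (Fin (2 * m))) : Prop :=
  ∃ u v : Fin (2 * m), u.val % 2 = 0 ∧ v.val % 2 = 1 ∧ SpiderAdj m u v ∧
    (P = exchange u v ∨ Pᶜ = exchange u v)

lemma isEdgeSet_compl {m : ℕ} (P : Finset (Fin (2 * m))) :
    IsEdgeSet m Pᶜ ↔ IsEdgeSet m P := by
  simp only [IsEdgeSet, compl_compl, or_comm]

open Classical in
/-- The coloring: one color for the distinguished equipartition, one for the edges of the spider,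
one for everything else. -/
noncomputable def color (m : ℕ) (P : Finset (Fin (2 * m))) : Fin 3 :=
  if P = evens m ∨ Pᶜ = evens m then 2 else if IsEdgeSet m P then 1 else 0

lemma color_compl {m : ℕ} (P : Finset (Fin (2 * m))) : color m Pᶜ = color m P := by
  have h := isEdgeSet_compl P
  unfold color
  split_ifs <;> simp_all

lemma color_eq_two {m : ℕ} {P : Finset (Fin (2 * m))} :
    color m P = 2 ↔ P = evens m ∨ Pᶜ = evens m := by
  unfold color; split_ifs <;> simp_all

lemma color_eq_one {m : ℕ} {P : Finset (Fin (2 * m))} :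
    color m P = 1 ↔ ¬ (P = evens m ∨ Pᶜ = evens m) ∧ IsEdgeSet m P := by
  unfold color; split_ifs <;> simp_all

lemma exists_even_avoiding {m : ℕ} (hm : 4 ≤ m) (a b : Fin (2 * m)) :
    ∃ x : Fin (2 * m), x.val % 2 = 0 ∧ x ≠ a ∧ x ≠ b := by
  have h : ∃ k, k < 3 ∧ 2 * k ≠ a.val ∧ 2 * k ≠ b.val := by
    by_contra! h
    have h0 := h 0
    have h1 := h 1
    have h2 := h 2
    omega
  obtain ⟨k, hk, ha, hb⟩ := h
  exact ⟨⟨2 * k, by omega⟩, by simp, fun e => ha (by simp [← e]), fun e => hb (by simp [← e])⟩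

lemma color_exchange {m : ℕ} (hm : 4 ≤ m) {u v : Fin (2 * m)} (hu : u.val % 2 = 0)
    (hv : v.val % 2 = 1) (h : SpiderAdj m u v) : color m (exchange u v) = 1 := by
  refine color_eq_one.2 ⟨?_, u, v, hu, hv, h, Or.inl rfl⟩
  rintro (h | h)
  · have := Finset.ext_iff.1 h v
    simp [mem_exchange, mem_evens, hv] at this
  · obtain ⟨x, hx, hxu, -⟩ := exists_even_avoiding hm u u
    have := Finset.ext_iff.1 h x
    simp [mem_exchange, mem_evens, hx, hxu] at this

lemma mem_image_perm {α : Type*} [DecidableEq α] (σ : Equiv.Perm α) (P : Finset α) (x : α) :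
    σ x ∈ P.image σ ↔ x ∈ P := by
  simp

/-- A permutation preserving the coloring preserves the parity classes up to swapping them. -/
lemma parity_of_color_preserving {m : ℕ} {σ : Equiv.Perm (Fin (2 * m))}
    (hσ : ∀ P : Finset (Fin (2 * m)), P.card = m → color m (P.image σ) = color m P) :
    (∀ x, (σ x).val % 2 = 0 ↔ x.val % 2 = 0) ∨ (∀ x, (σ x).val % 2 = 0 ↔ x.val % 2 = 1) := by
  have h := hσ _ (card_evens m)
  rw [color_eq_two.2 (Or.inl rfl : evens m = evens m ∨ _), color_eq_two] at h
  rcases h with h | h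
  · left
    intro x
    rw [← mem_evens, ← h, mem_image_perm, mem_evens]
  · right
    intro x
    rw [← mem_evens, ← h, mem_compl, mem_image_perm, mem_evens]
    omega

/-- A permutation preserving the coloring maps edges of the spider to edges. -/
lemma adj_of_color_preserving {m : ℕ} (hm : 4 ≤ m) {σ : Equiv.Perm (Fin (2 * m))}
    (hσ : ∀ P : Finset (Fin (2 * m)), P.card = m → color m (P.image σ) = color m P)
    {u v : Fin (2 * m)} (h : SpiderAdj m u v) : SpiderAdj m (σ u) (σ v) := by
  wlog hu : u.val % 2 = 0 generalizing u v
  · exact (this h.symm (by unfold SpiderAdj at h; omega)).symm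
  have hv : v.val % 2 = 1 := by unfold SpiderAdj at h; omega
  have hc := hσ _ (card_exchange hu hv)
  rw [color_exchange hm hu hv h, color_eq_one] at hc
  obtain ⟨-, u', v', hu', hv', h', hP⟩ := hc
  have huv : (σ u = u' ∧ σ v = v') ∨ (σ u = v' ∧ σ v = u') := by
    rcases hP with hP | hP
    · have key (x) : (σ x = v' ∨ (σ x ≠ u' ∧ (σ x).val % 2 = 0)) ↔
          (x = v ∨ (x ≠ u ∧ x.val % 2 = 0)) := by
        rw [← mem_exchange, ← mem_exchange, ← hP, mem_image_perm]
      rcases parity_of_color_preserving hσ with hp | hp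
      · left
        have := key u; have := key v; have := hp u; have := hp v
        grind
      · obtain ⟨x, hx, hxu, hxv⟩ := exists_even_avoiding hm u (σ.symm v')
        have : σ x ≠ v' := fun e => hxv (by simp [← e])
        have := key x; have := hp x
        grind
    · have key (x) : (σ x = v' ∨ (σ x ≠ u' ∧ (σ x).val % 2 = 0)) ↔
          ¬ (x = v ∨ (x ≠ u ∧ x.val % 2 = 0)) := by
        rw [← mem_exchange, ← mem_exchange, ← hP, mem_compl, mem_image_perm]
      rcases parity_of_color_preserving hσ with hp | hp
      · obtain ⟨x, hx, hxu, hxv⟩ := exists_even_avoiding hm u (σ.symm u')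
        have : σ x ≠ u' := fun e => hxv (by simp [← e])
        have := key x; have := hp x
        grind
      · right
        have := key u; have := key v; have := hp u; have := hp v
        grind
  rcases huv with ⟨h1, h2⟩ | ⟨h1, h2⟩
  · rwa [h1, h2]
  · rw [h1, h2]
    exact h'.symm

/-- The spider with legs of lengths `1`, `2`, `2 * m - 4` is asymmetric. -/
lemma eq_of_spiderAdj_preserving {m : ℕ} (hm : 4 ≤ m) {f : ℕ → ℕ}
    (hf : ∀ x < 2 * m, f x < 2 * m) (hinj : ∀ x < 2 * m, ∀ y < 2 * m, f x = f y → x = y)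
    (hadj : ∀ x < 2 * m, ∀ y < 2 * m, SpiderAdj m x y → SpiderAdj m (f x) (f y)) :
    ∀ x < 2 * m, f x = x := by
  have hsucc (i : ℕ) (hi : i + 1 < 2 * m - 1) : SpiderAdj m (f i) (f (i + 1)) :=
    hadj i (by omega) (i + 1) (by omega) (Or.inl ⟨rfl, by omega⟩)
  have hne (i j : ℕ) (hi : i < 2 * m) (hj : j < 2 * m) (hij : i ≠ j) : f i ≠ f j :=
    fun h => hij (hinj i hi j hj h)
  have a01 := hsucc 0 (by omega)
  have a12 := hsucc 1 (by omega)
  have a23 := hsucc 2 (by omega)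
  have a34 := hsucc 3 (by omega)
  have a45 := hsucc 4 (by omega)
  have a2l := hadj 2 (by omega) (2 * m - 1) (by omega) (by unfold SpiderAdj; omega)
  have n13 := hne 1 3 (by omega) (by omega) (by omega)
  have n1l := hne 1 (2 * m - 1) (by omega) (by omega) (by omega)
  have n3l := hne 3 (2 * m - 1) (by omega) (by omega) (by omega)
  have n02 := hne 0 2 (by omega) (by omega) (by omega)
  have n24 := hne 2 4 (by omega) (by omega) (by omega)
  have n35 := hne 3 5 (by omega) (by omega) (by omega)
  have hl := hf (2 * m - 1) (by omega)
  have b0 := hf 0 (by omega)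
  have b4 := hf 4 (by omega)
  simp only [SpiderAdj, Nat.reduceAdd, Nat.zero_add] at a01 a12 a23 a34 a45 a2l
  have h2 : f 2 = 2 := by clear a01 a34 a45; omega
  have h1l : f 1 ≠ 2 * m - 1 := by clear a34 a45 a2l a23; omega
  have h3l : f 3 ≠ 2 * m - 1 := by clear a01 a45 a2l a12; omega
  have hfl : f (2 * m - 1) = 2 * m - 1 := by clear a01 a34 a45; omega
  have h3 : f 3 = 3 := by clear a01 a2l; omega
  have h1 : f 1 = 1 := by clear a01 a34 a45; omega
  have h0 : f 0 = 0 := by clear a34 a45; omega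
  have hpath (i : ℕ) : i + 1 < 2 * m - 1 → f i = i ∧ f (i + 1) = i + 1 := by
    induction i with
    | zero => exact fun _ => ⟨h0, h1⟩
    | succ i ih =>
      intro hi
      obtain ⟨e0, e1⟩ := ih (by omega)
      have a := hsucc (i + 1) hi
      have n := hne i (i + 1 + 1) (by omega) (by omega) (by omega)
      have n' := hne (i + 1 + 1) (2 * m - 1) (by omega) (by omega) (by omega)
      unfold SpiderAdj at a
      omega
  intro x hx
  rcases Nat.lt_or_ge (x + 1) (2 * m - 1) with h | h
  · exact (hpath x h).1
  · obtain rfl | rfl : x = 2 * m - 1 ∨ x = 2 * m - 3 + 1 := by omega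
    · exact hfl
    · exact (hpath (2 * m - 3) (by omega)).2

end EquipartitionColoring


/-- For `n = 2m` with `m ≥ 4`, there is a 3-coloring of the set of equipartitions
of `[n]` (encoded as a complement-invariant 3-coloring `c` of the `m`-subsets of
`[n]`, so that `c` descends to unordered partitions `{P, [n] ∖ P}`) such that the
identity is the only permutation of `[n]` preserving the color of every
equipartition under the induced action. -/
theorem stmt_9 (m : ℕ) (hm : 4 ≤ m) :
    ∃ c : Finset (Fin (2 * m)) → Fin 3,
      (∀ P : Finset (Fin (2 * m)), P.card = m → c Pᶜ = c P) ∧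
      (∀ σ : Equiv.Perm (Fin (2 * m)),
        (∀ P : Finset (Fin (2 * m)), P.card = m → c (P.image σ) = c P) → σ = 1) := by
  open EquipartitionColoring in
  refine ⟨color m, fun P _ => color_compl P, fun σ hσ => ?_⟩
  have h := eq_of_spiderAdj_preserving hm
    (f := fun x => if hx : x < 2 * m then (σ ⟨x, hx⟩).val else 0)
    (fun x hx => by simp [hx])
    (fun x hx y hy hxy => by
      simpa [hx, hy, Fin.val_inj] using hxy)
    (fun x hx y hy hxy => by
      simpa [hx, hy] using
        adj_of_color_preserving hm hσ (u := ⟨x, hx⟩) (v := ⟨y, hy⟩) hxy)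
  ext x
  simpa using h x x.isLt
end

section
/- For every non-identity permutation β of [2m] with m ≥ 4, the number of equipartitions of [2m] fixed (set-wise, as unordered partitions) by the induced action of β is at most C(2m−2, m−2). -/
open scoped Classical

open Finset in
theorem card_filter_card_eq_and_mem_mem_le {α : Type*} [Fintype α] [DecidableEq α] {a b : α}
    (hab : a ≠ b) (m : ℕ) :
    #{P : Finset α | #P = m ∧ a ∈ P ∧ b ∈ P} ≤ (Fintype.card α - 2).choose (m - 2) := by
  have hcard : #(univ \ {a, b} : Finset α) = Fintype.card α - 2 := by
    rw [card_sdiff_of_subset (subset_univ _), card_univ, card_pair hab]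
  rw [← hcard, ← card_powersetCard]
  refine card_le_card_of_injOn (fun P => P \ {a, b}) ?_ ?_
  · intro P hP
    obtain ⟨hP, ha, hb⟩ := (mem_filter.1 hP).2
    refine mem_coe.2 (mem_powersetCard.2 ⟨sdiff_subset_sdiff (subset_univ _) subset_rfl, ?_⟩)
    rw [card_sdiff_of_subset (by grind), card_pair hab, hP]
  · intro P hP Q hQ h
    obtain ⟨-, hPa, hPb⟩ := (mem_filter.1 hP).2
    obtain ⟨-, hQa, hQb⟩ := (mem_filter.1 hQ).2
    ext x
    have := congrArg (x ∈ ·) h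
    grind

/-- The permutation `β` maps `P` either onto itself or onto its complement. -/
def PreservesOrSwaps {α : Type*} (β : Equiv.Perm α) (P : Finset α) : Prop :=
  (∀ x, β x ∈ P ↔ x ∈ P) ∨ ∀ x, β x ∈ P ↔ x ∉ P

open Finset in
theorem preservesOrSwaps_of_image_pair_eq {α : Type*} [Fintype α] [DecidableEq α]
    {β : Equiv.Perm α} {P : Finset α}
    (h : ({P, Pᶜ} : Finset (Finset α)).image (fun P => P.image β) = {P, Pᶜ}) :
    PreservesOrSwaps β P := by
  have hP : P.image β ∈ ({P, Pᶜ} : Finset (Finset α)) :=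
    h ▸ mem_image_of_mem _ (mem_insert_self _ _)
  have key (x : α) : β x ∈ P.image β ↔ x ∈ P := β.injective.mem_finset_image
  rcases mem_insert.1 hP with hP | hP
  · left
    intro x
    rw [← key x, hP]
  · right
    intro x
    rw [← key x, mem_singleton.1 hP, mem_compl, not_not]

open Finset in
theorem card_fixed_pairs_le {α : Type*} [Fintype α] [DecidableEq α] {m : ℕ}
    (hα : Fintype.card α = 2 * m) (β : Equiv.Perm α) (a : α) :
    #{A : Finset (Finset α) | (∃ P : Finset α, #P = m ∧ A = {P, Pᶜ}) ∧
      A.image (fun P => P.image β) = A} ≤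
    #{P : Finset α | #P = m ∧ a ∈ P ∧ PreservesOrSwaps β P} := by
  refine le_trans (card_le_card ?_)
    (card_image_le (f := fun P : Finset α => ({P, Pᶜ} : Finset (Finset α))))
  intro A hA
  obtain ⟨⟨P, hP, rfl⟩, hfix⟩ := (mem_filter.1 hA).2
  have hcompl : ({Pᶜ, Pᶜᶜ} : Finset (Finset α)) = {P, Pᶜ} := by
    rw [compl_compl, pair_comm]
  by_cases ha : a ∈ P
  · exact mem_image.2
      ⟨P, mem_filter.2 ⟨mem_univ _, hP, ha, preservesOrSwaps_of_image_pair_eq hfix⟩, rfl⟩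
  · refine mem_image.2 ⟨Pᶜ, mem_filter.2 ⟨mem_univ _, ?_, mem_compl.2 ha,
      preservesOrSwaps_of_image_pair_eq (by rw [hcompl, hfix])⟩, hcompl⟩
    rw [card_compl, hP, hα]
    omega

open Finset in
/-- If `β` does not square to the identity at `a`, exchanging `β (β a)` for `β a` injects the
swapped sets containing `a` into the non-invariant sets containing `a` and `β a`. -/
theorem card_preservesOrSwaps_le_of_apply_apply_ne {α : Type*} [Fintype α] [DecidableEq α]
    (m : ℕ) {β : Equiv.Perm α} {a : α} (h2 : β (β a) ≠ a) :
    #{P : Finset α | #P = m ∧ a ∈ P ∧ PreservesOrSwaps β P} ≤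
    #{P : Finset α | #P = m ∧ a ∈ P ∧ β a ∈ P} := by
  have h1 : β a ≠ a := fun h => h2 (by rw [h, h])
  have h3 : β (β a) ≠ β a := fun h => h1 (β.injective h)
  refine card_le_card_of_injOn
    (fun P => if β a ∈ P then P else insert (β a) (P.erase (β (β a)))) ?_ ?_
  · intro P hP
    obtain ⟨hP, ha, hβ⟩ := (mem_filter.1 hP).2
    refine mem_coe.2 (mem_filter.2 ⟨mem_univ _, ?_⟩)
    by_cases hb : β a ∈ P
    · simp [hb, hP, ha]
    · have hd : β (β a) ∈ P := by
        rcases hβ with hβ | hβ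
        · exact absurd ((hβ a).2 ha) hb
        · exact (hβ _).2 hb
      simp only [hb, if_false]
      refine ⟨?_, by grind, by grind⟩
      rw [card_insert_of_notMem (by grind), card_erase_add_one hd, hP]
  · intro P hP Q hQ h
    obtain ⟨-, hPa, hPβ⟩ := (mem_filter.1 hP).2
    obtain ⟨-, hQa, hQβ⟩ := (mem_filter.1 hQ).2
    have hPd : β (β a) ∈ P := by
      rcases hPβ with hβ | hβ <;> grind
    have hQd : β (β a) ∈ Q := by
      rcases hQβ with hβ | hβ <;> grind
    have hmem (x : α) := congrArg (x ∈ ·) h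
    have := hmem (β (β a))
    ext x
    have := hmem x
    grind

open Finset in
/-- For an involution with two further disjoint transposed pairs `{d, β d}` and `{e, β e}`,
inserting `β a` and deleting the element of one of these pairs, chosen according to whether
`d` and `e` lie on the same side, injects the swapped sets containing `a` into the non-invariant
sets containing `a` and `β a`. -/
theorem card_preservesOrSwaps_le_of_involutive {α : Type*} [Fintype α] [DecidableEq α]
    (m : ℕ) {β : Equiv.Perm α} {a d e : α} (h2 : ∀ x, β (β x) = x)
    (hda : d ≠ a) (hdb : d ≠ β a) (hea : e ≠ a) (heb : e ≠ β a) (hed : e ≠ d) (hed' : e ≠ β d) :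
    #{P : Finset α | #P = m ∧ a ∈ P ∧ PreservesOrSwaps β P} ≤
    #{P : Finset α | #P = m ∧ a ∈ P ∧ β a ∈ P} := by
  have hda' : β d ≠ a := by grind
  have hdb' : β d ≠ β a := β.injective.ne hda
  have hea' : β e ≠ a := by grind
  have heb' : β e ≠ β a := β.injective.ne hea
  have hed'' : β e ≠ d := by grind
  have hed''' : β e ≠ β d := β.injective.ne hed
  refine card_le_card_of_injOn
    (fun P => if β a ∈ P then P else insert (β a) (P.erase
      (if d ∈ P ↔ e ∈ P then (if e ∈ P then e else β e) else (if d ∈ P then d else β d)))) ?_ ?_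
  · intro P hP
    obtain ⟨hP, ha, hβ⟩ := (mem_filter.1 hP).2
    refine mem_coe.2 (mem_filter.2 ⟨mem_univ _, ?_⟩)
    by_cases hb : β a ∈ P
    · simp [hb, hP, ha]
    · have hβ : ∀ x, β x ∈ P ↔ x ∉ P := by
        rcases hβ with hβ | hβ
        · exact absurd ((hβ a).2 ha) hb
        · exact hβ
      have hd := hβ d
      have he := hβ e
      simp only [hb, if_false]
      refine ⟨?_, by grind, by grind⟩
      rw [card_insert_of_notMem (by grind), card_erase_add_one (by grind), hP]
  · intro P hP Q hQ h
    obtain ⟨-, hPa, hPβ⟩ := (mem_filter.1 hP).2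
    obtain ⟨-, hQa, hQβ⟩ := (mem_filter.1 hQ).2
    have hmem (x : α) : x ∈ _ ↔ x ∈ _ := Finset.ext_iff.1 h x
    have md := hmem d
    have md' := hmem (β d)
    have me := hmem e
    have me' := hmem (β e)
    ext x
    have mx := hmem x
    clear hmem h hP hQ
    rcases hPβ with hβ | hβ <;> rcases hQβ with hγ | hγ <;>
    · have := hβ a
      have := hβ d
      have := hβ e
      have := hγ a
      have := hγ d
      have := hγ e
      clear hβ hγ
      grind

/-- For every non-identity permutation `β` of `[2m]` with `m ≥ 4`, the number of
equipartitions of `[2m]` (unordered partitions `{P, Pᶜ}` with `|P| = |Pᶜ| = m`)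
fixed set-wise by the induced action of `β` is at most `C(2m-2, m-2)`. -/
theorem stmt_10 (m : ℕ) (hm : 4 ≤ m) (β : Equiv.Perm (Fin (2 * m))) (hβ : β ≠ 1) :
    (Finset.univ.filter (fun A : Finset (Finset (Fin (2 * m))) =>
        (∃ P : Finset (Fin (2 * m)), P.card = m ∧ A = {P, Pᶜ}) ∧
        A.image (fun P => P.image β) = A)).card ≤ (2 * m - 2).choose (m - 2) := by
  have hcard : Fintype.card (Fin (2 * m)) = 2 * m := Fintype.card_fin _
  suffices ∃ a, β a ≠ a ∧
      (Finset.univ.filter fun P : Finset (Fin (2 * m)) => P.card = m ∧ a ∈ P ∧ PreservesOrSwaps β P).card ≤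
      (Finset.univ.filter fun P : Finset (Fin (2 * m)) => P.card = m ∧ a ∈ P ∧ β a ∈ P).card by
    obtain ⟨a, ha, hle⟩ := this
    have h₁ := card_fixed_pairs_le hcard β a
    have h₂ := card_filter_card_eq_and_mem_mem_le ha.symm m
    rw [hcard] at h₂
    convert h₁.trans (hle.trans (by convert h₂))
  by_cases h2 : ∀ x, β (β x) = x
  · obtain ⟨a, ha⟩ : ∃ a, β a ≠ a := by
      by_contra! h
      exact hβ (Equiv.ext h)
    refine ⟨a, ha, ?_⟩
    have hnotMem (s : Finset (Fin (2 * m))) (hs : s.card ≤ 4) : ∃ x, x ∉ s := by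
      by_contra! h
      rw [Finset.eq_univ_iff_forall.2 h, Finset.card_univ, hcard] at hs
      omega
    obtain ⟨d, hd⟩ := hnotMem {a, β a} (Finset.card_le_two.trans (by norm_num))
    obtain ⟨e, he⟩ := hnotMem {a, β a, d, β d} Finset.card_le_four
    simp only [Finset.mem_insert, Finset.mem_singleton, not_or] at hd he
    exact card_preservesOrSwaps_le_of_involutive m h2 hd.1 hd.2 he.1 he.2.1 he.2.2.1 he.2.2.2
  · push Not at h2
    obtain ⟨a, ha⟩ := h2
    refine ⟨a, fun h => ha (by rw [h, h]), ?_⟩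
    exact card_preservesOrSwaps_le_of_apply_apply_ne m ha
end
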